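/- Let 1 < k < n−1 and let C be a maximal clique of Δ_k(V) that is not a maximal star. Then C = T^c(Y) for some non-degenerate (k+1)-dimensional subspace Y of F^n if and only if for every non-degenerate (k−1)-dimensional subspace X of F^n the intersection C ∩ S(X) is either empty or contains at least two elements. -/

import Mathlib

open Module

section Defs

variable (F : Type*) [Field F]

/-- The `i`-th coordinate hyperplane in `F^n`: the kernel of the `i`-th coordinate functional. -/
def coordHyp (n : ℕ) (i : Fin n) : Submodule F (Fin n → F) :=
  LinearMap.ker (LinearMap.proj (R := F) (φ := fun _ : Fin n => F) i)

/-- A subspace of `F^n` is degenerate if it is contained in some coordinate hyperplane. -/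
def IsDeg (n : ℕ) (W : Submodule F (Fin n → F)) : Prop :=
  ∃ i : Fin n, W ≤ coordHyp F n i

/-- A subspace of `F^n` is non-degenerate if it is not degenerate. -/
def IsNondeg (n : ℕ) (W : Submodule F (Fin n → F)) : Prop :=
  ¬ IsDeg F n W

/-- Adjacency of `k`-dimensional subspaces: distinct with `(k-1)`-dimensional intersection. -/
def AdjK (n k : ℕ) (A B : Submodule F (Fin n → F)) : Prop :=
  A ≠ B ∧ finrank F ↥(A ⊓ B) = k - 1

/-- The star `S(X)`: all `k`-dimensional subspaces containing `X`. -/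
def Sstar (n k : ℕ) (X : Submodule F (Fin n → F)) : Set (Submodule F (Fin n → F)) :=
  {A | finrank F ↥A = k ∧ X ≤ A}

/-- `S^c(X)`: all non-degenerate `k`-dimensional subspaces containing `X`. -/
def Sc (n k : ℕ) (X : Submodule F (Fin n → F)) : Set (Submodule F (Fin n → F)) :=
  {A | finrank F ↥A = k ∧ X ≤ A ∧ IsNondeg F n A}

/-- `T^c(Y)`: all non-degenerate `k`-dimensional subspaces contained in `Y`. -/
def Tc (n k : ℕ) (Y : Submodule F (Fin n → F)) : Set (Submodule F (Fin n → F)) :=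
  {A | finrank F ↥A = k ∧ A ≤ Y ∧ IsNondeg F n A}

/-- A clique of `Δ_k(V)`: a set of non-degenerate `k`-dimensional subspaces which are
pairwise adjacent. -/
def IsCliqueD (n k : ℕ) (C : Set (Submodule F (Fin n → F))) : Prop :=
  (∀ A ∈ C, finrank F ↥A = k ∧ IsNondeg F n A) ∧
    ∀ A ∈ C, ∀ B ∈ C, A ≠ B → AdjK F n k A B

/-- A maximal clique of `Δ_k(V)`. -/
def IsMaxCliqueD (n k : ℕ) (C : Set (Submodule F (Fin n → F))) : Prop :=
  IsCliqueD F n k C ∧ ∀ D, IsCliqueD F n k D → C ⊆ D → D = C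

/-- A star of `Δ_k(V)`: a set `S^c(X)` which is a maximal clique of `Δ_k(V)`. -/
def IsStarD (n k : ℕ) (S : Set (Submodule F (Fin n → F))) : Prop :=
  (∃ X : Submodule F (Fin n → F), finrank F ↥X = k - 1 ∧ S = Sc F n k X) ∧
    IsMaxCliqueD F n k S

/-- A top of `Δ_k(V)`: a set `T^c(Y)` which is a maximal clique of `Δ_k(V)`. -/
def IsTopD (n k : ℕ) (T : Set (Submodule F (Fin n → F))) : Prop :=
  (∃ Y : Submodule F (Fin n → F), finrank F ↥Y = k + 1 ∧ T = Tc F n k Y) ∧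
    IsMaxCliqueD F n k T

/-- Adjacency of maximal cliques used in the graphs `Δ_s` and `Δ_t`:
two distinct cliques such that every vertex of each is adjacent to some vertex of the other. -/
def AdjMC (n k : ℕ) (C1 C2 : Set (Submodule F (Fin n → F))) : Prop :=
  C1 ≠ C2 ∧ (∀ A ∈ C1, ∃ B ∈ C2, AdjK F n k A B) ∧
    (∀ A ∈ C2, ∃ B ∈ C1, AdjK F n k A B)

/-- Adjacency in the graphs `Δ'_s` and `Δ'_t`: adjacent as above with empty intersection. -/
def AdjMC' (n k : ℕ) (C1 C2 : Set (Submodule F (Fin n → F))) : Prop :=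
  AdjMC F n k C1 C2 ∧ C1 ∩ C2 = ∅

/-- A clique of the graph `Δ_s` (whose vertices are the stars of `Δ_k(V)`). -/
def IsCliqueDs (n k : ℕ) (𝔖 : Set (Set (Submodule F (Fin n → F)))) : Prop :=
  (∀ S ∈ 𝔖, IsStarD F n k S) ∧ ∀ S ∈ 𝔖, ∀ S' ∈ 𝔖, S ≠ S' → AdjMC F n k S S'

/-- A maximal clique of `Δ_s`. -/
def IsMaxCliqueDs (n k : ℕ) (𝔖 : Set (Set (Submodule F (Fin n → F)))) : Prop :=
  IsCliqueDs F n k 𝔖 ∧ ∀ 𝔖', IsCliqueDs F n k 𝔖' → 𝔖 ⊆ 𝔖' → 𝔖' = 𝔖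

/-- A clique of the graph `Δ'_s`. -/
def IsCliqueDs' (n k : ℕ) (𝔖 : Set (Set (Submodule F (Fin n → F)))) : Prop :=
  (∀ S ∈ 𝔖, IsStarD F n k S) ∧ ∀ S ∈ 𝔖, ∀ S' ∈ 𝔖, S ≠ S' → AdjMC' F n k S S'

/-- A maximal clique of `Δ'_s`. -/
def IsMaxCliqueDs' (n k : ℕ) (𝔖 : Set (Set (Submodule F (Fin n → F)))) : Prop :=
  IsCliqueDs' F n k 𝔖 ∧ ∀ 𝔖', IsCliqueDs' F n k 𝔖' → 𝔖 ⊆ 𝔖' → 𝔖' = 𝔖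

/-- A special set of stars: a maximal clique in both `Δ_s` and `Δ'_s`. -/
def IsSpecialStars (n k : ℕ) (𝔖 : Set (Set (Submodule F (Fin n → F)))) : Prop :=
  IsMaxCliqueDs F n k 𝔖 ∧ IsMaxCliqueDs' F n k 𝔖

/-- A clique of the graph `Δ_t` (whose vertices are the tops of `Δ_k(V)`). -/
def IsCliqueDt (n k : ℕ) (𝔗 : Set (Set (Submodule F (Fin n → F)))) : Prop :=
  (∀ T ∈ 𝔗, IsTopD F n k T) ∧ ∀ T ∈ 𝔗, ∀ T' ∈ 𝔗, T ≠ T' → AdjMC F n k T T'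

/-- A maximal clique of `Δ_t`. -/
def IsMaxCliqueDt (n k : ℕ) (𝔗 : Set (Set (Submodule F (Fin n → F)))) : Prop :=
  IsCliqueDt F n k 𝔗 ∧ ∀ 𝔗', IsCliqueDt F n k 𝔗' → 𝔗 ⊆ 𝔗' → 𝔗' = 𝔗

/-- A clique of the graph `Δ'_t`. -/
def IsCliqueDt' (n k : ℕ) (𝔗 : Set (Set (Submodule F (Fin n → F)))) : Prop :=
  (∀ T ∈ 𝔗, IsTopD F n k T) ∧ ∀ T ∈ 𝔗, ∀ T' ∈ 𝔗, T ≠ T' → AdjMC' F n k T T'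

/-- A maximal clique of `Δ'_t`. -/
def IsMaxCliqueDt' (n k : ℕ) (𝔗 : Set (Set (Submodule F (Fin n → F)))) : Prop :=
  IsCliqueDt' F n k 𝔗 ∧ ∀ 𝔗', IsCliqueDt' F n k 𝔗' → 𝔗 ⊆ 𝔗' → 𝔗' = 𝔗

/-- A special set of tops: a maximal clique in both `Δ_t` and `Δ'_t`. -/
def IsSpecialTops (n k : ℕ) (𝔗 : Set (Set (Submodule F (Fin n → F)))) : Prop :=
  IsMaxCliqueDt F n k 𝔗 ∧ IsMaxCliqueDt' F n k 𝔗

/-- `𝔗_X`: the set of all `T^c(Y)` over non-degenerate `(k+1)`-dimensional `Y` containing `X`. -/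
def TopsThrough (n k : ℕ) (X : Submodule F (Fin n → F)) :
    Set (Set (Submodule F (Fin n → F))) :=
  {T | ∃ Y : Submodule F (Fin n → F),
    finrank F ↥Y = k + 1 ∧ IsNondeg F n Y ∧ X ≤ Y ∧ T = Tc F n k Y}

end Defs

section SubspaceDimension

variable {F V : Type*} [Field F] [AddCommGroup V] [Module F V] [FiniteDimensional F V]

/-- Every subspace contains subspaces of all smaller dimensions. -/
theorem exists_submodule_le_finrank_eq (W : Submodule F V) (m : ℕ) (hm : m ≤ finrank F W) :
    ∃ U ≤ W, finrank F U = m := by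
  induction m with
  | zero => exact ⟨⊥, bot_le, finrank_bot F V⟩
  | succ m ih =>
    obtain ⟨U, hUW, hU⟩ := ih (by omega)
    obtain ⟨v, hvW, hvU⟩ : ∃ v ∈ W, v ∉ U := by
      by_contra! h
      have := Submodule.finrank_mono (show W ≤ U from h)
      omega
    refine ⟨U ⊔ Submodule.span F {v}, sup_le hUW (by simpa using hvW), ?_⟩
    rw [Submodule.finrank_sup_span_singleton hvU, hU]

/-- Two distinct subspaces of equal dimension whose join has dimension at most one more
intersect in a subspace of dimension one less. -/
theorem finrank_inf_eq_of_finrank_sup_le {A B : Submodule F V} {k : ℕ} (hk : 1 ≤ k)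
    (hA : finrank F A = k) (hB : finrank F B = k) (hAB : A ≠ B)
    (h : finrank F ↥(A ⊔ B) ≤ k + 1) : finrank F ↥(A ⊓ B) = k - 1 := by
  have hlt : A < A ⊔ B := by
    refine left_lt_sup.2 fun hle => hAB ?_
    exact (Submodule.eq_of_le_of_finrank_eq hle (hB.trans hA.symm)).symm
  have h1 := Submodule.finrank_lt_finrank_of_lt hlt
  have h2 := Submodule.finrank_sup_add_finrank_inf_eq A B
  omega

/-- Two distinct subspaces of equal dimension containing a common subspace of dimension one less
intersect precisely in dimension one less. -/
theorem finrank_inf_eq_of_le_inf {A B X : Submodule F V} {k : ℕ} (hk : 1 ≤ k)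
    (hA : finrank F A = k) (hB : finrank F B = k) (hAB : A ≠ B)
    (hX : finrank F X = k - 1) (hXA : X ≤ A) (hXB : X ≤ B) : finrank F ↥(A ⊓ B) = k - 1 := by
  have h1 := Submodule.finrank_mono (le_inf hXA hXB)
  have h2 := Submodule.finrank_sup_add_finrank_inf_eq A B
  exact finrank_inf_eq_of_finrank_sup_le hk hA hB hAB (by omega)

/-- Two distinct hyperplanes of a subspace span it. -/
theorem sup_eq_of_finrank_eq_sub_one {P Q E : Submodule F V} {k : ℕ}
    (hP : finrank F P = k - 1) (hQ : finrank F Q = k - 1) (hE : finrank F E = k)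
    (hPE : P ≤ E) (hQE : Q ≤ E) (hPQ : P ≠ Q) : P ⊔ Q = E := by
  refine Submodule.eq_of_le_of_finrank_le (sup_le hPE hQE) ?_
  have hlt : P < P ⊔ Q := by
    refine left_lt_sup.2 fun hle => hPQ ?_
    exact (Submodule.eq_of_le_of_finrank_eq hle (hQ.trans hP.symm)).symm
  have := Submodule.finrank_lt_finrank_of_lt hlt
  omega

/-- A family of pairwise adjacent `k`-dimensional subspaces is contained in a star or, when
nonempty, in a top. -/
theorem exists_le_or_exists_ge_of_pairwise_finrank_inf {C : Set (Submodule F V)} {k : ℕ}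
    (hk : 1 ≤ k) (hkV : k ≤ finrank F V) (hC : ∀ A ∈ C, finrank F A = k)
    (hadj : ∀ A ∈ C, ∀ B ∈ C, A ≠ B → finrank F ↥(A ⊓ B) = k - 1) :
    (∃ X : Submodule F V, finrank F X = k - 1 ∧ ∀ A ∈ C, X ≤ A) ∨
      C.Nonempty ∧ ∃ Y : Submodule F V, finrank F Y = k + 1 ∧ ∀ A ∈ C, A ≤ Y := by
  rcases C.subsingleton_or_nontrivial with hsub | ⟨A, hA, B, hB, hAB⟩
  · left
    rcases hsub.eq_empty_or_singleton with rfl | ⟨A, rfl⟩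
    · obtain ⟨X, -, hX⟩ := exists_submodule_le_finrank_eq (⊤ : Submodule F V) (k - 1)
        (by rw [finrank_top]; omega)
      exact ⟨X, hX, by simp⟩
    · obtain ⟨X, hXA, hX⟩ := exists_submodule_le_finrank_eq A (k - 1) (by rw [hC A rfl]; omega)
      exact ⟨X, hX, by rintro _ rfl; exact hXA⟩
  by_cases hstar : ∀ D ∈ C, A ⊓ B ≤ D
  · exact Or.inl ⟨A ⊓ B, hadj A hA B hB hAB, hstar⟩
  right
  have hX := hadj A hA B hB hAB
  have key : ∀ D ∈ C, ¬ A ⊓ B ≤ D → D ≤ A ⊔ B := by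
    intro D hD hnD
    have hDA := hadj D hD A hA (by rintro rfl; exact hnD inf_le_left)
    have hDB := hadj D hD B hB (by rintro rfl; exact hnD inf_le_right)
    have hne : D ⊓ A ≠ D ⊓ B := by
      intro h
      have hle : D ⊓ A ≤ A ⊓ B := le_inf inf_le_right (h.le.trans inf_le_right)
      have heq := Submodule.eq_of_le_of_finrank_eq hle (hDA.trans hX.symm)
      exact hnD (heq.ge.trans inf_le_left)
    rw [← sup_eq_of_finrank_eq_sub_one hDA hDB (hC D hD) inf_le_left inf_le_left hne]
    exact sup_le_sup inf_le_right inf_le_right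
  push Not at hstar
  obtain ⟨D, hD, hnD⟩ := hstar
  refine ⟨⟨A, hA⟩, A ⊔ B, ?_, fun E hE => ?_⟩
  · have := Submodule.finrank_sup_add_finrank_inf_eq A B
    have := hC A hA
    have := hC B hB
    omega
  by_cases hEX : A ⊓ B ≤ E
  · have hED := hadj E hE D hD (by rintro rfl; exact hnD hEX)
    have hne : A ⊓ B ≠ E ⊓ D := fun h => hnD (h.le.trans inf_le_right)
    rw [← sup_eq_of_finrank_eq_sub_one hX hED (hC E hE) hEX inf_le_left hne]
    exact sup_le (inf_le_left.trans le_sup_left) (inf_le_right.trans (key D hD hnD))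
  · exact key E hE hEX

end SubspaceDimension

section Cliques

variable {F : Type*} [Field F] {n k : ℕ}

theorem IsNondeg.mono {U W : Submodule F (Fin n → F)} (hU : IsNondeg F n U) (h : U ≤ W) :
    IsNondeg F n W :=
  fun ⟨i, hi⟩ => hU ⟨i, h.trans hi⟩

theorem isNondeg_of_one_mem {W : Submodule F (Fin n → F)} (h : (1 : Fin n → F) ∈ W) :
    IsNondeg F n W := by
  rintro ⟨i, hi⟩
  have h1 : (1 : Fin n → F) i = 0 := hi h
  exact one_ne_zero h1

theorem isCliqueD_Sc (hk : 1 ≤ k) {X : Submodule F (Fin n → F)} (hX : finrank F X = k - 1) :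
    IsCliqueD F n k (Sc F n k X) :=
  ⟨fun _ hA => ⟨hA.1, hA.2.2⟩, fun _ hA _ hB hAB =>
    ⟨hAB, finrank_inf_eq_of_le_inf hk hA.1 hB.1 hAB hX hA.2.1 hB.2.1⟩⟩

theorem isCliqueD_Tc (hk : 1 ≤ k) {Y : Submodule F (Fin n → F)} (hY : finrank F Y = k + 1) :
    IsCliqueD F n k (Tc F n k Y) :=
  ⟨fun _ hA => ⟨hA.1, hA.2.2⟩, fun _ hA _ hB hAB =>
    ⟨hAB, finrank_inf_eq_of_finrank_sup_le hk hA.1 hB.1 hAB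
      (hY ▸ Submodule.finrank_mono (sup_le hA.2.1 hB.2.1))⟩⟩

/-- Every maximal clique of `Δ_k(V)` is of the form `S^c(X)` or `T^c(Y)` with `Y`
non-degenerate. -/
theorem IsMaxCliqueD.eq_Sc_or_eq_Tc (hk : 1 ≤ k) (hkn : k ≤ n)
    {C : Set (Submodule F (Fin n → F))} (hC : IsMaxCliqueD F n k C) :
    (∃ X : Submodule F (Fin n → F), finrank F X = k - 1 ∧ C = Sc F n k X) ∨
      ∃ Y : Submodule F (Fin n → F), finrank F Y = k + 1 ∧ IsNondeg F n Y ∧ C = Tc F n k Y := by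
  obtain ⟨⟨hCk, hCadj⟩, hmax⟩ := hC
  rcases exists_le_or_exists_ge_of_pairwise_finrank_inf hk (by simpa using hkn)
      (fun A hA => (hCk A hA).1) (fun A hA B hB hAB => (hCadj A hA B hB hAB).2) with
    ⟨X, hX, hCX⟩ | ⟨⟨A, hA⟩, Y, hY, hCY⟩
  · refine Or.inl ⟨X, hX, (hmax _ (isCliqueD_Sc hk hX) fun A hA => ?_).symm⟩
    exact ⟨(hCk A hA).1, hCX A hA, (hCk A hA).2⟩
  · refine Or.inr ⟨Y, hY, (hCk A hA).2.mono (hCY A hA),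
      (hmax _ (isCliqueD_Tc hk hY) fun B hB => ?_).symm⟩
    exact ⟨(hCk B hB).1, hCY B hB, (hCk B hB).2⟩

/-- A non-degenerate star meeting `T^c(Y)` meets it in at least two elements. -/
theorem exists_ne_mem_Tc_inter_Sstar (hk : 1 ≤ k) {X Y A : Submodule F (Fin n → F)}
    (hX : finrank F X = k - 1) (hXn : IsNondeg F n X) (hY : finrank F Y = k + 1)
    (hA : A ∈ Tc F n k Y ∩ Sstar F n k X) : ∃ B ∈ Tc F n k Y ∩ Sstar F n k X, A ≠ B := by
  obtain ⟨⟨hAk, hAY, -⟩, -, hXA⟩ := hA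
  obtain ⟨y, hyY, hyA⟩ : ∃ y ∈ Y, y ∉ A := by
    by_contra! h
    have := Submodule.finrank_mono (show Y ≤ A from h)
    omega
  have hyB : y ∈ X ⊔ Submodule.span F {y} :=
    Submodule.mem_sup_right (Submodule.mem_span_singleton_self y)
  have hBk : finrank F ↥(X ⊔ Submodule.span F {y}) = k := by
    rw [Submodule.finrank_sup_span_singleton fun h => hyA (hXA h)]
    omega
  exact ⟨X ⊔ Submodule.span F {y},
    ⟨⟨hBk, sup_le (hXA.trans hAY) (by simpa using hyY), hXn.mono le_sup_left⟩, hBk, le_sup_left⟩,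
    fun h => hyA (h ▸ hyB)⟩

/-- For degenerate `X₀`, some non-degenerate star meets `S^c(X₀)` in exactly one element. -/
theorem exists_Sc_inter_Sstar_eq_singleton (hk : 1 < k) {X₀ : Submodule F (Fin n → F)}
    (hX₀ : finrank F X₀ = k - 1) (hdeg : IsDeg F n X₀) :
    ∃ X A : Submodule F (Fin n → F), finrank F X = k - 1 ∧ IsNondeg F n X ∧
      Sc F n k X₀ ∩ Sstar F n k X = {A} := by
  have h1 : (1 : Fin n → F) ∉ X₀ := fun h => isNondeg_of_one_mem h hdeg
  obtain ⟨H, hHX, hH⟩ := exists_submodule_le_finrank_eq X₀ (k - 2) (by omega)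
  have hmem (W : Submodule F (Fin n → F)) : (1 : Fin n → F) ∈ W ⊔ Submodule.span F {1} :=
    Submodule.mem_sup_right (Submodule.mem_span_singleton_self _)
  have hA : finrank F ↥(X₀ ⊔ Submodule.span F {(1 : Fin n → F)}) = k := by
    rw [Submodule.finrank_sup_span_singleton h1]
    omega
  refine ⟨H ⊔ Submodule.span F {1}, X₀ ⊔ Submodule.span F {1}, ?_,
    isNondeg_of_one_mem (hmem H), ?_⟩
  · rw [Submodule.finrank_sup_span_singleton fun h => h1 (hHX h)]
    omega
  · ext B
    rw [Set.mem_singleton_iff]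
    constructor
    · rintro ⟨⟨hBk, hXB, -⟩, -, hB⟩
      exact (Submodule.eq_of_le_of_finrank_eq (sup_le hXB (le_sup_right.trans hB))
        (hA.trans hBk.symm)).symm
    · rintro rfl
      exact ⟨⟨hA, le_sup_left, isNondeg_of_one_mem (hmem X₀)⟩, hA, sup_le_sup_right hHX _⟩

theorem Sc_eq_Sstar {X : Submodule F (Fin n → F)} (hX : IsNondeg F n X) :
    Sc F n k X = Sstar F n k X :=
  Set.ext fun _ => ⟨fun h => ⟨h.1, h.2.1⟩, fun h => ⟨h.1, h.2, hX.mono h.2⟩⟩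

end Cliques

/-- a maximal clique of `Δ_k(V)` which is not a maximal star is a top
iff its intersection with every maximal star is empty or contains at least two elements. -/
theorem stmt6 (F : Type*) [Field F] (n k : ℕ)
    (hk1 : 1 < k) (hk2 : k < n - 1)
    (C : Set (Submodule F (Fin n → F))) (hC : IsMaxCliqueD F n k C)
    (hns : ¬ ∃ X : Submodule F (Fin n → F),
        finrank F ↥X = k - 1 ∧ IsNondeg F n X ∧ C = Sstar F n k X) :
    (∃ Y : Submodule F (Fin n → F),
        finrank F ↥Y = k + 1 ∧ IsNondeg F n Y ∧ C = Tc F n k Y) ↔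
      ∀ X : Submodule F (Fin n → F), finrank F ↥X = k - 1 → IsNondeg F n X →
        (C ∩ Sstar F n k X = ∅ ∨
          ∃ A ∈ C ∩ Sstar F n k X, ∃ B ∈ C ∩ Sstar F n k X, A ≠ B) := by
  constructor
  · rintro ⟨Y, hY, -, rfl⟩ X hX hXn
    rcases Set.eq_empty_or_nonempty (Tc F n k Y ∩ Sstar F n k X) with h | ⟨A, hA⟩
    · exact Or.inl h
    · exact Or.inr ⟨A, hA, exists_ne_mem_Tc_inter_Sstar hk1.le hX hXn hY hA⟩
  · intro h
    rcases hC.eq_Sc_or_eq_Tc hk1.le (by omega) with ⟨X₀, hX₀, rfl⟩ | hY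
    · have hdeg : IsDeg F n X₀ := by
        by_contra hn
        exact hns ⟨X₀, hX₀, hn, Sc_eq_Sstar hn⟩
      obtain ⟨X, A, hX, hXn, hXA⟩ := exists_Sc_inter_Sstar_eq_singleton hk1 hX₀ hdeg
      rcases h X hX hXn with h0 | ⟨B, hB, B', hB', hne⟩
      · exact absurd (hXA.symm.trans h0) (Set.singleton_ne_empty A)
      · rw [hXA] at hB hB'
        exact absurd (hB.trans hB'.symm) hne
    · exact hY
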